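/- (Convexity Condition, part 1: perimeter minimality among supersets.) Let C ⊆ ℝ² be a bounded measurable set with 0 < vol(C) < ∞ and 0 < Per(C) < ∞, set λ_C = Per(C)/vol(C), and suppose C is calibrable: there exists a measurable ξ : ℝ² → ℝ² with ‖ξ(x)‖ ≤ 1 for almost every x and with distributional divergence λ_C·χ_C. Then for every bounded measurable set D ⊆ ℝ² with C ⊆ D, Per(C) ≤ Per(D). -/

import Mathlib

open MeasureTheory RealInnerProductSpace
open scoped ENNReal

/-- The Euclidean plane. -/
abbrev Plane := EuclideanSpace ℝ (Fin 2)

/-- The divergence of a planar vector field: the trace of its Fréchet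
derivative. -/
noncomputable def divg (F : Plane → Plane) (x : Plane) : ℝ :=
  LinearMap.trace ℝ Plane (fderiv ℝ F x).toLinearMap

/-- The values `∫_E div ξ` over smooth compactly supported fields `ξ` with
`‖ξ‖ ≤ 1`, whose supremum is the variational perimeter of `E`. -/
def perimVals (E : Set Plane) : Set ℝ≥0∞ :=
  {r | ∃ ξ : Plane → Plane, ContDiff ℝ (⊤ : ℕ∞) ξ ∧ HasCompactSupport ξ ∧
    (∀ x, ‖ξ x‖ ≤ 1) ∧ r = ENNReal.ofReal (∫ x in E, divg ξ x)}

/-- The variational perimeter of a set `E ⊆ ℝ²`. -/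
noncomputable def Per (E : Set Plane) : ℝ≥0∞ := sSup (perimVals E)

/-- `η` has distributional divergence `λ · χ_C`:
`∫ ⟨η, ∇φ⟩ = -λ ∫_C φ` for every smooth compactly supported `φ`. -/
def HasDistribDiv (η : Plane → Plane) (lam : ℝ) (C : Set Plane) : Prop :=
  ∀ φ : Plane → ℝ, ContDiff ℝ (⊤ : ℕ∞) φ → HasCompactSupport φ →
    ∫ x : Plane, ⟪η x, gradient φ x⟫ = -lam * ∫ x in C, φ x

open MeasureTheory RealInnerProductSpace Filter Topology Convolution ContinuousLinearMap in
/-- The divergence of the mollification of a locally integrable field. -/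
theorem divg_convolution {ρ : Plane → ℝ} (hρ : ContDiff ℝ (⊤ : ℕ∞) ρ)
    (hρc : HasCompactSupport ρ) {η : Plane → Plane} (hη : LocallyIntegrable η) (x : Plane) :
    divg (ρ ⋆[lsmul ℝ ℝ, volume] η) x = ∫ y, fderiv ℝ ρ (x - y) (η y) := by
  have h1 : ContDiff ℝ 1 ρ := hρ.of_le (by exact_mod_cast le_top)
  rw [divg, (hρc.hasFDerivAt_convolution_left (lsmul ℝ ℝ) h1 hη x).fderiv]
  have hint := (hρc.fderiv (𝕜 := ℝ)).convolutionExists_left ((lsmul ℝ ℝ).precompL Plane)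
    (h1.continuous_fderiv one_ne_zero) hη x
  let T : (Plane →L[ℝ] Plane) →L[ℝ] ℝ :=
    (LinearMap.trace ℝ Plane ∘ₗ ContinuousLinearMap.coeLM ℝ).toContinuousLinearMap
  rw [convolution_eq_swap]
  change T (∫ _, _) = _
  rw [← T.integral_comp_comm hint.integrable_swap]
  refine integral_congr_ae (.of_forall fun y ↦ ?_)
  exact LinearMap.trace_smulRight (fderiv ℝ ρ (x - y)).toLinearMap (η y)

/-- Mollification turns a distributional divergence into a classical one. -/
theorem HasDistribDiv.divg_convolution {ρ : Plane → ℝ} (hρ : ContDiff ℝ (⊤ : ℕ∞) ρ)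
    (hρc : HasCompactSupport ρ) {η : Plane → Plane} (hη : LocallyIntegrable η)
    {lam : ℝ} {C : Set Plane} (hdiv : HasDistribDiv η lam C) (hC : MeasurableSet C) (x : Plane) :
    divg (convolution ρ η (ContinuousLinearMap.lsmul ℝ ℝ) volume) x =
      lam * convolution ρ (C.indicator 1) (ContinuousLinearMap.lsmul ℝ ℝ) volume x := by
  have hφ : ContDiff ℝ (⊤ : ℕ∞) fun y ↦ ρ (x - y) := hρ.comp (contDiff_const.sub contDiff_id)
  have hφc : HasCompactSupport fun y ↦ ρ (x - y) :=
    hρc.comp_homeomorph (Homeomorph.subLeft x)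
  have key := hdiv _ hφ hφc
  have hg (y : Plane) : ⟪η y, gradient (fun y ↦ ρ (x - y)) y⟫ = -fderiv ℝ ρ (x - y) (η y) := by
    have hd : HasFDerivAt ρ (fderiv ℝ ρ (x - y)) (x - y) :=
      (hρ.differentiable (by simp) _).hasFDerivAt
    have hcomp : HasFDerivAt (fun y ↦ ρ (x - y)) _ y :=
      hd.comp y ((hasFDerivAt_id y).const_sub x)
    rw [real_inner_comm, gradient, InnerProductSpace.toDual_symm_apply, hcomp.fderiv]
    simp
  simp only [hg, integral_neg] at key
  rw [_root_.divg_convolution hρ hρc hη, convolution_lsmul_swap, ← neg_inj, key,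
    ← integral_indicator hC, neg_mul]
  congr 3 with y
  by_cases hy : y ∈ C <;> simp [hy]

/-- Averaging against a probability density does not increase a uniform bound. -/
theorem norm_convolution_lsmul_le {F : Type*} [NormedAddCommGroup F] [NormedSpace ℝ F]
    {ρ : Plane → ℝ} (hρ0 : ∀ x, 0 ≤ ρ x) (hρi : Integrable ρ) (hρ1 : ∫ x, ρ x = 1)
    {η : Plane → F} (hη : ∀ x, ‖η x‖ ≤ 1) (x : Plane) :
    ‖convolution ρ η (ContinuousLinearMap.lsmul ℝ ℝ) volume x‖ ≤ 1 := by
  rw [convolution_lsmul, ← hρ1]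
  refine norm_integral_le_of_norm_le hρi (.of_forall fun t ↦ ?_)
  rw [norm_smul, Real.norm_of_nonneg (hρ0 t)]
  exact mul_le_of_le_one_right (hρ0 t) (hη _)

/-- Smooth fields bounded by one, not necessarily compactly supported, also test the perimeter of
a bounded set. -/
theorem ofReal_integral_divg_le_Per {D : Set Plane} (hD : MeasurableSet D)
    (hDb : Bornology.IsBounded D) {F : Plane → Plane} (hF : ContDiff ℝ (⊤ : ℕ∞) F)
    (hF1 : ∀ x, ‖F x‖ ≤ 1) : ENNReal.ofReal (∫ x in D, divg F x) ≤ Per D := by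
  obtain ⟨R, hR, hDR⟩ := hDb.subset_ball_lt 0 0
  let ψ : ContDiffBump (0 : Plane) := ⟨R, R + 1, hR, lt_add_one R⟩
  refine le_sSup ⟨fun x ↦ ψ x • F x, ψ.contDiff.smul hF, ψ.hasCompactSupport.smul_right,
    fun x ↦ ?_, ?_⟩
  · rw [norm_smul, Real.norm_of_nonneg ψ.nonneg]
    exact mul_le_one₀ ψ.le_one (norm_nonneg _) (hF1 x)
  · congr 1
    refine setIntegral_congr_fun hD fun x hx ↦ ?_
    have hev : (fun x ↦ ψ x • F x) =ᶠ[nhds x] F := by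
      filter_upwards [Metric.isOpen_ball.mem_nhds (hDR hx)] with y hy
      rw [ψ.one_of_mem_closedBall (Metric.ball_subset_closedBall hy), one_smul]
    simp only [divg, hev.fderiv_eq]

/-- A field bounded by one almost everywhere with distributional divergence `lam · χ_C` bounds
from below the perimeter of every bounded superset of `C`. -/
theorem HasDistribDiv.ofReal_mul_volume_le_Per {η : Plane → Plane} (hηm : Measurable η)
    (hη1 : ∀ᵐ x, ‖η x‖ ≤ 1) {lam : ℝ} {C D : Set Plane} (hdiv : HasDistribDiv η lam C)
    (hC : MeasurableSet C) (hCD : C ⊆ D) (hD : MeasurableSet D) (hDb : Bornology.IsBounded D) :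
    ENNReal.ofReal (lam * volume.real C) ≤ Per D := by
  wlog hη : ∀ x, ‖η x‖ ≤ 1 generalizing η
  · have hS : MeasurableSet {x | ‖η x‖ ≤ 1} := measurableSet_le hηm.norm measurable_const
    have hb (x : Plane) : ‖{x | ‖η x‖ ≤ 1}.indicator η x‖ ≤ 1 := by
      by_cases hx : ‖η x‖ ≤ 1 <;> simp [Set.indicator, hx]
    refine this (hηm.indicator hS) (.of_forall hb) (fun φ hφ hφc ↦ ?_) hb
    rw [← hdiv φ hφ hφc]
    refine integral_congr_ae (hη1.mono fun x hx ↦ ?_)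
    simp [Set.indicator, hx]
  have hloc : LocallyIntegrable η :=
    (locallyIntegrable_const (1 : ℝ)).mono hηm.aestronglyMeasurable
      (.of_forall fun x ↦ by simpa using hη x)
  let φ (n : ℕ) : ContDiffBump (0 : Plane) :=
    ⟨1 / (n + 1), 2 * (1 / (n + 1)), by positivity, by
      have : (0 : ℝ) < 1 / (n + 1) := by positivity
      linarith⟩
  let u (n : ℕ) : Plane → ℝ :=
    convolution ((φ n).normed volume) (C.indicator 1) (ContinuousLinearMap.lsmul ℝ ℝ) volume
  have hρ (n : ℕ) : ContDiff ℝ (⊤ : ℕ∞) ((φ n).normed volume) := (φ n).contDiff_normed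
  have hχm : Measurable (C.indicator (1 : Plane → ℝ)) := measurable_one.indicator hC
  have hχb (x : Plane) : ‖C.indicator (1 : Plane → ℝ) x‖ ≤ 1 := by
    by_cases hx : x ∈ C <;> simp [hx]
  have hχ : LocallyIntegrable (C.indicator (1 : Plane → ℝ)) :=
    (locallyIntegrable_const (1 : ℝ)).mono hχm.aestronglyMeasurable
      (.of_forall fun x ↦ by simpa using hχb x)
  have hlim : ∀ᵐ x, Filter.Tendsto (fun n ↦ u n x) Filter.atTop
      (nhds (C.indicator (1 : Plane → ℝ) x)) := by
    refine ContDiffBump.ae_convolution_tendsto_right_of_locallyIntegrable (K := 2) ?_ ?_ hχ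
    · simpa [φ] using (tendsto_one_div_add_atTop_nhds_zero_nat (𝕜 := ℝ)).const_mul 2
    · exact .of_forall fun n ↦ le_rfl
  have htend : Filter.Tendsto (fun n ↦ ∫ x in D, u n x) Filter.atTop
      (nhds (volume.real C)) := by
    have hCint : ∫ x in D, C.indicator (1 : Plane → ℝ) x = volume.real C := by
      rw [integral_indicator_one hC, measureReal_restrict_apply hC,
        Set.inter_eq_left.mpr hCD]
    rw [← hCint]
    refine tendsto_integral_of_dominated_convergence (fun _ ↦ (1 : ℝ)) (fun n ↦ ?_)
      (integrableOn_const hDb.measure_lt_top.ne) (fun n ↦ .of_forall fun x ↦ ?_)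
      (ae_restrict_of_ae hlim)
    · exact ((φ n).hasCompactSupport_normed.continuous_convolution_left _
        (φ n).continuous_normed hχ).aestronglyMeasurable
    · exact norm_convolution_lsmul_le (φ n).nonneg_normed (φ n).integrable_normed
        (φ n).integral_normed hχb x
  refine le_of_tendsto (ENNReal.tendsto_ofReal (htend.const_mul lam)) (.of_forall fun n ↦ ?_)
  have h := ofReal_integral_divg_le_Per hD hDb
    ((φ n).hasCompactSupport_normed.contDiff_convolution_left (ContinuousLinearMap.lsmul ℝ ℝ)
      (hρ n) hloc)
    (norm_convolution_lsmul_le (φ n).nonneg_normed (φ n).integrable_normed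
        (φ n).integral_normed hη)
  simpa only [hdiv.divg_convolution (hρ n) (φ n).hasCompactSupport_normed hloc hC,
    integral_const_mul] using h

/-- Convexity condition, part 1: a calibrable set minimizes perimeter among its
bounded measurable supersets. -/
theorem calibrable_perimeter_minimal_among_supersets
    (C : Set Plane) (hC : MeasurableSet C) (hCbdd : Bornology.IsBounded C)
    (hv0 : volume C ≠ 0) (hvT : volume C ≠ ⊤)
    (hp0 : Per C ≠ 0) (hpT : Per C ≠ ⊤)
    (ξ : Plane → Plane) (hξm : Measurable ξ)
    (hξ1 : ∀ᵐ x : Plane, ‖ξ x‖ ≤ 1)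
    (hdiv : HasDistribDiv ξ ((Per C).toReal / (volume C).toReal) C) :
    ∀ D : Set Plane, C ⊆ D → MeasurableSet D → Bornology.IsBounded D →
      Per C ≤ Per D := by
  intro D hCD hD hDb
  have h := hdiv.ofReal_mul_volume_le_Per hξm hξ1 hC hCD hD hDb
  rwa [measureReal_def, div_mul_cancel₀ _ (ENNReal.toReal_ne_zero.mpr ⟨hv0, hvT⟩),
    ENNReal.ofReal_toReal hpT] at h
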